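/- Under hypotheses (H1)–(H4), the central cross-section K₀ satisfies 1/(3n) ≤ |K₀| ≤ 1. -/

import Mathlib

open MeasureTheory Set
open scoped Pointwise in
lemma BM1 (A B C : Set ℝ) (hA : MeasurableSet A) (hB : MeasurableSet B) (hA0 : A.Nonempty) (hB0 : B.Nonempty)
    (t : ℝ) (ht : 0 < t) (ht1 : t < 1) (h : ∀ x ∈ A, ∀ y ∈ B, t * x + (1-t) * y ∈ C) :
    ENNReal.ofReal t * volume A + ENNReal.ofReal (1-t) * volume B ≤ volume C := by
  obtain ⟨a0, ha0⟩ := hA0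
  obtain ⟨b0, hb0⟩ := hB0
  have aff : ∀ (c d : ℝ) (hc : 0 < c) (S : Set ℝ), volume ((fun x => c * x + d) '' S) = ENNReal.ofReal c * volume S := by
    intro c d hc S
    have : (fun x => c * x + d) '' S = (fun x => x + d) '' (c • S) := by
      rw [← image_smul, image_image]; simp
    rw [this, image_add_right, measure_preimage_add_right, Measure.addHaar_smul]
    simp [abs_of_pos hc]
  have key : ∀ K ⊆ A, IsCompact K → K.Nonempty → ∀ L ⊆ B, IsCompact L → L.Nonempty →
      ENNReal.ofReal t * volume K + ENNReal.ofReal (1-t) * volume L ≤ volume C := by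
    intro K hK hKc hK0 L hL hLc hL0
    obtain ⟨k, hk, hk'⟩ := hKc.exists_isGreatest hK0
    obtain ⟨l, hl, hl'⟩ := hLc.exists_isLeast hL0
    rw [← aff t ((1-t)*l) ht K, ← aff (1-t) (t*k) (by linarith) L,
      ← measure_inter_add_sdiff C (measurableSet_Iic (a := t*k+(1-t)*l))]
    have h1t : 0 < 1 - t := by linarith
    gcongr ?_ + ?_
    · apply measure_mono
      rintro _ ⟨x, hx, rfl⟩
      refine ⟨h _ (hK hx) _ (hL hl), ?_⟩
      have := hk' hx
      simp only [mem_Iic]; gcongr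
    · rw [← measure_sdiff_null (s := (fun x => (1-t) * x + t*k) '' L) (t := {t*k+(1-t)*l}) (by simp)]
      apply measure_mono
      rintro _ ⟨⟨x, hx, rfl⟩, hne⟩
      refine ⟨?_, ?_⟩
      · have := h _ (hK hk) _ (hL hx); rwa [add_comm] at this
      · have := hl' hx
        simp only [mem_Iic, not_le]
        simp only [mem_singleton_iff] at hne
        have h2 : (1-t)*l ≤ (1-t)*x := by gcongr
        apply lt_of_le_of_ne (by linarith) (Ne.symm hne)
  have key' : ∀ K ⊆ A, IsCompact K → ∀ L ⊆ B, IsCompact L →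
      ENNReal.ofReal t * volume K + ENNReal.ofReal (1-t) * volume L ≤ volume C := by
    intro K hK hKc L hL hLc
    refine le_trans ?_ (key (insert a0 K) (insert_subset ha0 hK) (hKc.insert a0) (by simp) (insert b0 L)
       (insert_subset hb0 hL) (hLc.insert b0) (by simp))
    gcongr <;> exact subset_insert _ _
  have ne : ∀ D : Set ℝ, Nonempty {i : Set ℝ // i ⊆ D ∧ IsCompact i} := fun D => ⟨⟨∅, by simp⟩⟩
  have reg : ∀ D : Set ℝ, MeasurableSet D → volume D = ⨆ i : {i : Set ℝ // i ⊆ D ∧ IsCompact i}, volume i.1 := by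
    intro D hD
    rw [hD.measure_eq_iSup_isCompact]
    simp only [iSup_and', iSup_subtype']
  have := ne A
  have := ne B
  rw [reg A hA, reg B hB, ENNReal.mul_iSup, ENNReal.mul_iSup, ENNReal.iSup_add]
  refine iSup_le fun K => ?_
  rw [ENNReal.add_iSup]
  exact iSup_le fun L => key' _ K.2.1 K.2.2 _ L.2.1 L.2.2

lemma layer (f : ℝ → ENNReal) (hf : Measurable f) (h1 : ∀ x, f x ≤ 1) :
    ∫⁻ x, f x = ∫⁻ l in Ioo (0:ℝ) 1, volume {x | ENNReal.ofReal l < f x} := by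
  have hfin : ∀ x, f x ≠ ⊤ := fun x => ((h1 x).trans_lt (by simp)).ne
  have := lintegral_eq_lintegral_meas_lt (volume : Measure ℝ) (f := fun x => (f x).toReal)
    (Filter.Eventually.of_forall fun x => ENNReal.toReal_nonneg) hf.ennreal_toReal.aemeasurable
  simp only [ENNReal.ofReal_toReal (hfin _)] at this
  rw [this, ← Ioo_union_Ici_eq_Ioi (zero_lt_one), lintegral_union measurableSet_Ici]
  · have e1 : ∫⁻ l in Ici (1:ℝ), volume {x | l < (f x).toReal} = 0 := by
      rw [setLIntegral_congr_fun (g := fun _ => 0) measurableSet_Ici]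
      · simp
      · intro l hl
        have : {x | l < (f x).toReal} = ∅ := by
          ext x
          simp only [mem_ofPred_eq, mem_empty_iff_false, iff_false, not_lt]
          exact le_trans (ENNReal.toReal_le_of_le_ofReal zero_le_one (by simpa using h1 x)) hl
        simp [this]
    rw [e1, add_zero]
    apply setLIntegral_congr_fun measurableSet_Ioo
    intro l hl
    simp only
    congr 1; ext x
    simp only [mem_ofPred_eq]
    rw [ENNReal.ofReal_lt_iff_lt_toReal hl.1.le (hfin x)]
  · rw [Set.disjoint_left]; intro x hx hx'; exact absurd hx.2 (not_lt.2 hx')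

lemma PL_norm (f g h : ℝ → ENNReal) (hf : Measurable f) (hg : Measurable g) (hh : Measurable h)
    (f1 : ∀ x, f x ≤ 1) (g1 : ∀ x, g x ≤ 1) (f2 : ∀ c < 1, ∃ x, c < f x) (g2 : ∀ c < 1, ∃ x, c < g x)
    (t : ℝ) (ht : 0 < t) (ht1 : t < 1)
    (H : ∀ x y, f x ^ t * g y ^ (1-t) ≤ h (t * x + (1-t) * y)) :
    ENNReal.ofReal t * (∫⁻ x, f x) + ENNReal.ofReal (1-t) * (∫⁻ x, g x) ≤ ∫⁻ x, h x := by
  have h1t : 0 < 1 - t := by linarith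
  have : ∫⁻ x, min (h x) 1 ≤ ∫⁻ x, h x := lintegral_mono fun x => min_le_left _ _
  refine le_trans ?_ this
  have mono : ∀ f : ℝ → ENNReal, Measurable fun l : ℝ => volume {x | ENNReal.ofReal l < f x} := by
    intro f
    apply Antitone.measurable
    intro a b hab
    apply measure_mono
    intro x hx
    exact lt_of_le_of_lt (ENNReal.ofReal_le_ofReal hab) hx
  rw [layer f hf f1, layer g hg g1, layer _ (hh.min measurable_const) (fun x => min_le_right _ _),
    ← lintegral_const_mul _ (mono f), ← lintegral_const_mul _ (mono g), ← lintegral_add_left ((mono f).const_mul _)]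
  apply setLIntegral_mono' measurableSet_Ioo
  intro l hl
  have hl1 : ENNReal.ofReal l < 1 := by simpa using hl.2
  refine BM1 _ _ _ (measurableSet_lt measurable_const hf) (measurableSet_lt measurable_const hg)
    (f2 _ hl1) (g2 _ hl1) t ht ht1 ?_
  intro x hx y hy
  simp only [mem_ofPred_eq] at hx hy ⊢
  refine lt_min ?_ hl1
  refine lt_of_lt_of_le ?_ (H x y)
  have e : ENNReal.ofReal l = ENNReal.ofReal l ^ t * ENNReal.ofReal l ^ (1-t) := by
    rw [← ENNReal.rpow_add _ _ (by simpa using hl.1) (by simp)]; simp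
  rw [e]
  exact ENNReal.mul_lt_mul (ENNReal.rpow_lt_rpow hx ht) (ENNReal.rpow_lt_rpow hy h1t)

lemma amgm (a b : ENNReal) (t : ℝ) (ht : 0 < t) (ht1 : t < 1) :
    a ^ t * b ^ (1-t) ≤ ENNReal.ofReal t * a + ENNReal.ofReal (1-t) * b := by
  have h1t : 0 < 1 - t := by linarith
  have := ENNReal.young_inequality (a^t) (b^(1-t)) (p := t⁻¹) (q := (1-t)⁻¹)
    (by rw [Real.holderConjugate_iff]; exact ⟨(one_lt_inv₀ ht).2 ht1, by simp⟩)
  rw [← ENNReal.rpow_mul, ← ENNReal.rpow_mul, mul_inv_cancel₀ ht.ne', mul_inv_cancel₀ h1t.ne',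
    ENNReal.rpow_one, ENNReal.rpow_one, ENNReal.ofReal_inv_of_pos ht, ENNReal.ofReal_inv_of_pos h1t,
    div_eq_mul_inv, div_eq_mul_inv, inv_inv, inv_inv, mul_comm a, mul_comm b] at this
  exact this

lemma PL_bdd (f g h : ℝ → ENNReal) (hf : Measurable f) (hg : Measurable g) (hh : Measurable h)
    (M : ENNReal) (hM : M ≠ ⊤)
    (f1 : ∀ x, f x ≤ M) (g1 : ∀ x, g x ≤ M) 
    (t : ℝ) (ht : 0 < t) (ht1 : t < 1)
    (H : ∀ x y, f x ^ t * g y ^ (1-t) ≤ h (t * x + (1-t) * y)) :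
    (∫⁻ x, f x) ^ t * (∫⁻ x, g x) ^ (1-t) ≤ ∫⁻ x, h x := by
  have h1t : 0 < 1 - t := by linarith
  set a := ⨆ x, f x with ha
  set b := ⨆ x, g x with hb
  have haT : a ≠ ⊤ := ((iSup_le f1).trans_lt hM.lt_top).ne
  have hbT : b ≠ ⊤ := ((iSup_le g1).trans_lt hM.lt_top).ne
  by_cases ha0 : a = 0
  · have : ∀ x, f x = 0 := fun x => le_antisymm (ha0 ▸ le_iSup f x) (zero_le)
    simp [this, ht]
  by_cases hb0 : b = 0
  · have : ∀ x, g x = 0 := fun x => le_antisymm (hb0 ▸ le_iSup g x) (zero_le)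
    simp [this, h1t]
  have n1 : ∀ (f : ℝ → ENNReal) (a : ENNReal), a = ⨆ x, f x → a ≠ 0 → a ≠ ⊤ → ∀ x, f x * a⁻¹ ≤ 1 := by
    intro f a h h0 hT x
    rw [← ENNReal.mul_inv_cancel h0 hT]
    gcongr
    rw [h]; exact le_iSup f x
  have n2 : ∀ (f : ℝ → ENNReal) (a : ENNReal), a = ⨆ x, f x → a ≠ 0 → a ≠ ⊤ → ∀ c < 1, ∃ x, c < f x * a⁻¹ := by
    intro f a h h0 hT c hc
    have : c * a < ⨆ x, f x := by
      rw [← h]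
      calc c * a < 1 * a := (ENNReal.mul_lt_mul_iff_left h0 hT).2 hc
        _ = a := one_mul a
    obtain ⟨x, hx⟩ := lt_iSup_iff.1 this
    refine ⟨x, ?_⟩
    rw [← div_eq_mul_inv, ENNReal.lt_div_iff_mul_lt (.inl h0) (.inl hT)]
    exact hx
  set d := a ^ t * b ^ (1-t) with hd
  have hd0 : d ≠ 0 := by simp [hd, ha0, hb0, haT, hbT]
  have hdT : d ≠ ⊤ := ENNReal.mul_ne_top (by simp [haT, ha0, ht.le]) (by simp [hbT, hb0, h1t.le])
  have dinv : d⁻¹ = a⁻¹ ^ t * b⁻¹ ^ (1-t) := by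
    rw [hd, ENNReal.inv_rpow, ENNReal.inv_rpow, ENNReal.mul_inv]
    · left; simp [ha0, haT]
    · left; simp [ha0, haT, ht.le]
  have key := PL_norm (fun x => f x * a⁻¹) (fun x => g x * b⁻¹) (fun x => h x * d⁻¹)
    (hf.mul_const _) (hg.mul_const _) (hh.mul_const _) (n1 f a ha ha0 haT) (n1 g b hb hb0 hbT)
    (n2 f a ha ha0 haT) (n2 g b hb hb0 hbT) t ht ht1 (by
      intro x y
      rw [dinv, ENNReal.mul_rpow_of_nonneg _ _ ht.le, ENNReal.mul_rpow_of_nonneg _ _ h1t.le, mul_mul_mul_comm]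
      gcongr
      exact H x y)
  replace key := (amgm _ _ t ht ht1).trans key
  rw [lintegral_mul_const _ hf, lintegral_mul_const _ hg, lintegral_mul_const _ hh,
    ENNReal.mul_rpow_of_nonneg _ _ ht.le, ENNReal.mul_rpow_of_nonneg _ _ h1t.le, mul_mul_mul_comm, ← dinv] at key
  exact (ENNReal.mul_le_mul_iff_left (by simp [hdT]) (by simp [hd0])).1 key

lemma PL_one (f g h : ℝ → ENNReal) (hf : Measurable f) (hg : Measurable g) (hh : Measurable h)
    (t : ℝ) (ht : 0 < t) (ht1 : t < 1)
    (H : ∀ x y, f x ^ t * g y ^ (1-t) ≤ h (t * x + (1-t) * y)) :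
    (∫⁻ x, f x) ^ t * (∫⁻ x, g x) ^ (1-t) ≤ ∫⁻ x, h x := by
  have h1t : 0 < 1 - t := by linarith
  have lim : ∀ f : ℝ → ENNReal, Measurable f → ∫⁻ x, f x = ⨆ N : ℕ, ∫⁻ x, min (f x) N := by
    intro f hf
    rw [← lintegral_iSup (fun N => hf.min measurable_const)]
    · congr 1; ext x
      rw [← inf_iSup_eq, ENNReal.iSup_natCast, inf_top_eq]
    · intro a b hab x
      simp only; gcongr
  have mono : ∀ f : ℝ → ENNReal, Monotone (fun N : ℕ => ∫⁻ x, min (f x) N) := by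
    intro f a b hab
    simp only; gcongr
  have rp : ∀ (u : ℕ → ENNReal) (s : ℝ), 0 < s → (⨆ N, u N) ^ s = ⨆ N, u N ^ s := by
    intro u s hs
    exact (ENNReal.orderIsoRpow s hs).map_iSup u
  rw [lim f hf, lim g hg, rp _ _ ht, rp _ _ h1t, ENNReal.iSup_mul]
  refine iSup_le fun i => ?_
  rw [ENNReal.mul_iSup]
  refine iSup_le fun j => ?_
  have := PL_bdd (fun x => min (f x) (max i j : ℕ)) (fun x => min (g x) (max i j : ℕ)) h 
     (hf.min measurable_const) (hg.min measurable_const) hh (max i j : ℕ) (by simp) (fun x => min_le_right _ _) (fun x => min_le_right _ _) t ht ht1 (fun x y => le_trans (by gcongr <;> exact min_le_left _ _) (H x y))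
  refine le_trans ?_ this
  gcongr ?_ ^ t * ?_ ^ (1-t)
  · exact mono f (le_max_left i j)
  · exact mono g (le_max_right i j)

lemma fub (k : ℕ) (f : (Fin (k+1) → ℝ) → ENNReal) (hf : Measurable f) :
   Measurable (fun s : ℝ => ∫⁻ y : Fin k → ℝ, f (Fin.cons s y)) ∧
   (∀ s, Measurable fun y : Fin k → ℝ => f (Fin.cons s y)) ∧ 
   ∫⁻ x, f x = ∫⁻ s : ℝ, ∫⁻ y : Fin k → ℝ, f (Fin.cons s y) := by
  have mp := (volume_preserving_piFinSuccAbove (fun _ : Fin (k+1) => ℝ) 0).symm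
  have hE : ∀ p : ℝ × (Fin k → ℝ), (MeasurableEquiv.piFinSuccAbove (fun _ : Fin (k+1) => ℝ) 0).symm p
      = Fin.cons p.1 p.2 := by
    intro p
    simp [MeasurableEquiv.piFinSuccAbove]
    rfl
  have hm : Measurable fun p : ℝ × (Fin k → ℝ) => f (Fin.cons p.1 p.2) := by
    have := hf.comp mp.measurable
    convert this using 1
    funext p
    rw [Function.comp, hE]
  refine ⟨hm.lintegral_prod_right', fun s => hm.comp measurable_prodMk_left, ?_⟩
  rw [← mp.lintegral_comp hf]
  simp only [hE]
  exact lintegral_prod (μ := (volume : Measure ℝ)) (ν := (volume : Measure (Fin k → ℝ))) _ hm.aemeasurable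

lemma PL (k : ℕ) (f g h : (Fin k → ℝ) → ENNReal) (hf : Measurable f) (hg : Measurable g) (hh : Measurable h)
    (t : ℝ) (ht : 0 < t) (ht1 : t < 1)
    (H : ∀ x y, f x ^ t * g y ^ (1-t) ≤ h (t • x + (1-t) • y)) :
    (∫⁻ x, f x) ^ t * (∫⁻ x, g x) ^ (1-t) ≤ ∫⁻ x, h x := by
  induction k with
  | zero => 
    rw [lintegral_unique, lintegral_unique, lintegral_unique]
    simp only [volume_pi, Measure.pi_univ, Finset.univ_eq_empty, Finset.prod_empty, mul_one]
    convert H default default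
  | succ k ih =>
    obtain ⟨f1, f2, f3⟩ := fub k f hf
    obtain ⟨g1, g2, g3⟩ := fub k g hg
    obtain ⟨h1, h2, h3⟩ := fub k h hh
    rw [f3, g3, h3]
    apply PL_one _ _ _ f1 g1 h1 t ht ht1
    intro x y
    apply ih _ _ _ (f2 _) (g2 _) (h2 _)
    intro u v
    convert H (Fin.cons x u) (Fin.cons y v) using 2
    ext i
    refine Fin.cases ?_ (fun j => ?_) i <;> simp

lemma BMconv (k : ℕ) (A B C : Set (EuclideanSpace ℝ (Fin k))) (hA : MeasurableSet A) (hB : MeasurableSet B)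
    (hC : MeasurableSet C) (t : ℝ) (ht : 0 < t) (ht1 : t < 1)
    (H : ∀ x ∈ A, ∀ y ∈ B, t • x + (1-t) • y ∈ C) :
    volume A ^ t * volume B ^ (1-t) ≤ volume C := by
  have h1t : 0 < 1 - t := by linarith
  have mp := PiLp.volume_preserving_toLp (Fin k)
  have e : ∀ A : Set (EuclideanSpace ℝ (Fin k)), MeasurableSet A → volume A = ∫⁻ x, (WithLp.toLp 2 ⁻¹' A).indicator 1 x := by
    intro A hA
    rw [lintegral_indicator_one (mp.measurable hA), mp.measure_preimage hA.nullMeasurableSet]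
  rw [e A hA, e B hB, e C hC]
  refine PL k _ _ _ (measurable_one.indicator (mp.measurable hA)) (measurable_one.indicator (mp.measurable hB))
   (measurable_one.indicator (mp.measurable hC)) t ht ht1 ?_
  intro x y
  by_cases hx : WithLp.toLp 2 x ∈ A
  · by_cases hy : WithLp.toLp 2 y ∈ B
    · have := H _ hx _ hy
      have h3 : t • x + (1-t) • y ∈ WithLp.toLp 2 ⁻¹' C := this
      rw [indicator_of_mem h3]
      simp [indicator, hx, hy]
    · simp [indicator, hy, h1t]
  · simp [indicator, hx, ht]
lemma oneD (f : ℝ → ℝ) (hi : Integrable (fun x => x * f x)) (hnn : ∀ x, 0 ≤ f x) (R m : ℝ) (hR : 0 < R)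
   (hm : 0 < m) (hsupp : ∀ x, x ≤ -R → f x = 0) (hfm : f m = 1) (hlc : ∀ x y t, 0 < t → t < 1 → f x ^ t * f y ^ (1-t) ≤ f (t * x + (1-t) * y))
   (hne : ¬ f =ᵐ[volume] 0) (h0 : ∫ x, x * f x = 0) : Real.exp (-1) ≤ f 0 := by
  by_contra hcon
  rw [not_le] at hcon
  have left : ∀ x < 0, f x ^ (m / (m - x)) ≤ f 0 := by
    intro x hx
    have hmx : 0 < m - x := by linarith
    have := hlc x m (m / (m-x)) (by positivity) ((div_lt_one hmx).2 (by linarith))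
    rw [hfm, Real.one_rpow, mul_one] at this
    convert this using 2
    field_simp; ring
  rcases (hnn 0).eq_or_lt with hz | hpos
  · apply hne
    have hl : ∀ x < 0, f x = 0 := by
      intro x hx
      have h1 := left x hx
      rw [← hz] at h1
      have hmx : 0 < m - x := by linarith
      have h2 : f x ^ (m / (m - x)) = 0 := le_antisymm h1 (Real.rpow_nonneg (hnn x) _)
      rw [Real.rpow_eq_zero (hnn x) (by positivity)] at h2
      exact h2
    have hnn' : 0 ≤ fun x => x * f x := by
      intro x
      rcases lt_or_ge x 0 with h | h
      · simp [hl x h]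
      · exact mul_nonneg h (hnn x)
    have := (integral_eq_zero_iff_of_nonneg hnn' hi).1 h0
    have hx0 : ∀ᵐ x : ℝ, x ≠ 0 := by simp [ae_iff]
    filter_upwards [this, hx0] with x hx h'
    simpa [h'] using hx
  · set L := -Real.log (f 0) with hL
    have hL1 : 1 < L := by
      have : Real.log (f 0) < -1 := by rw [Real.log_lt_iff_lt_exp hpos]; exact hcon
      linarith
    have hf0 : f 0 = Real.exp (-L) := by rw [hL, neg_neg, Real.exp_log hpos]
    set c := L / m with hc
    have hcpos : 0 < c := by positivity
    have cm : c * m = L := by rw [hc]; field_simp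
    let φ : ℝ → ℝ := fun x => Real.exp (c * x - L)
    have c1 : ∀ x < 0, f x ≤ φ x := by
      intro x hx
      have hmx : 0 < m - x := by linarith
      have h1 := left x hx
      have h2 : (f x ^ (m/(m-x))) ^ ((m-x)/m) ≤ f 0 ^ ((m-x)/m) := by
        have := hnn x
        gcongr
      rw [← Real.rpow_mul (hnn x), show m / (m - x) * ((m - x) / m) = 1 by field_simp, Real.rpow_one,
        hf0, ← Real.exp_mul] at h2
      convert h2 using 2
      rw [hc]; field_simp; ring
    have c2 : ∀ x, 0 < x → x ≤ m → φ x ≤ f x := by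
      intro x hx hxm
      rcases hxm.eq_or_lt with rfl | hlt
      · simp [φ, cm, hfm]
      · have := hlc 0 m ((m-x)/m) (by apply div_pos <;> linarith) ((div_lt_one hm).2 (by linarith))
        rw [hfm, Real.one_rpow, mul_one, hf0, ← Real.exp_mul] at this
        convert this using 2
        · rw [hc]; field_simp; ring
        · field_simp; ring
    have hcont : Continuous (fun x => x * φ x) := by fun_prop
    have hle : ∫ x in Ioc (-R) m, x * φ x ≤ ∫ x, x * f x := by
      rw [← integral_indicator measurableSet_Ioc]
      apply integral_mono _ hi
      · intro x
        by_cases hx : x ∈ Ioc (-R) m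
        · simp only [indicator_of_mem hx]
          rcases lt_trichotomy x 0 with h | h | h
          · have := c1 x h; nlinarith
          · simp [h]
          · have := c2 x h hx.2; gcongr
        · simp only [indicator_of_notMem hx]
          rcases le_or_gt x (-R) with h | h
          · simp [hsupp x h]
          · have : m < x := by
              by_contra h'; exact hx ⟨h, not_lt.1 h'⟩
            exact mul_nonneg (by linarith) (hnn x)
      · exact (hcont.integrableOn_Ioc).integrable_indicator measurableSet_Ioc
    rw [← intervalIntegral.integral_of_le (by linarith)] at hle
    have hd : ∀ x ∈ uIcc (-R) m, HasDerivAt (fun x => (x / c - 1/c^2) * Real.exp (c*x-L)) (x * φ x) x := by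
      intro x _
      have h1 : HasDerivAt (fun x : ℝ => x / c - 1/c^2) (1/c) x := ((hasDerivAt_id x).div_const c).sub_const _
      have h2 : HasDerivAt (fun x : ℝ => Real.exp (c*x-L)) (Real.exp (c*x-L) * (c * 1)) x :=
        (((hasDerivAt_id x).const_mul c).sub_const L).exp
      refine (h1.mul h2).congr_deriv ?_
      change _ = x * Real.exp (c * x - L)
      field_simp; ring
    rw [intervalIntegral.integral_eq_sub_of_hasDerivAt hd (hcont.intervalIntegrable _ _), h0] at hle
    have p1 : 0 < (m / c - 1/c^2) * Real.exp (c*m-L) := by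
      apply mul_pos _ (Real.exp_pos _)
      have : m / c - 1/c^2 = (L - 1)/c^2 := by rw [← cm]; field_simp
      rw [this]; apply div_pos <;> nlinarith
    have p2 : (-R / c - 1/c^2) * Real.exp (c*(-R)-L) < 0 := by
      apply mul_neg_of_neg_of_pos _ (Real.exp_pos _)
      have : 0 < R / c := by positivity
      have : 0 < 1/c^2 := by positivity
      rw [neg_div]; linarith
    linarith

theorem central_section_bounds (n : ℕ) (hn : 2 ≤ n)
    (K : Set (ℝ × EuclideanSpace ℝ (Fin (n - 1))))
    (hKcomp : IsCompact K) (hKconv : Convex ℝ K)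
    -- (H1): the centroid of K is the origin
    (hH1 : (∫ p in K, p) = 0)
    -- (H3): max_x |K_x| = 1
    (hH3le : ∀ x : ℝ, volume {y : EuclideanSpace ℝ (Fin (n - 1)) | (x, y) ∈ K} ≤ 1)
    (hH3eq : ∃ x : ℝ, volume {y : EuclideanSpace ℝ (Fin (n - 1)) | (x, y) ∈ K} = 1)
    -- (H4): |K| = 1
    (hH4 : volume K = 1) :
    1 / (3 * (n : ENNReal)) ≤ volume {y : EuclideanSpace ℝ (Fin (n - 1)) | ((0:ℝ), y) ∈ K}
      ∧ volume {y : EuclideanSpace ℝ (Fin (n - 1)) | ((0:ℝ), y) ∈ K} ≤ 1 := by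
  refine ⟨?_, hH3le 0⟩
  obtain ⟨m, hm⟩ := hH3eq
  set F : ℝ → ENNReal := fun x => volume {y : EuclideanSpace ℝ (Fin (n - 1)) | (x, y) ∈ K} with hF
  have hKm : MeasurableSet K := hKcomp.measurableSet
  have hfib : ∀ x, MeasurableSet {y : EuclideanSpace ℝ (Fin (n - 1)) | (x, y) ∈ K} := fun x =>
    measurable_prodMk_left hKm
  have hFT : ∀ x, F x ≠ ⊤ := fun x => ((hH3le x).trans_lt (by simp)).ne
  set f : ℝ → ℝ := fun x => (F x).toReal with hf
  have hnn : ∀ x, 0 ≤ f x := fun x => ENNReal.toReal_nonneg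
  have hfm : f m = 1 := by simp only [hf, hF]; rw [hm]; simp
  have hlc : ∀ x y t, 0 < t → t < 1 → f x ^ t * f y ^ (1-t) ≤ f (t * x + (1-t) * y) := by
    intro x y t ht ht1
    have := BMconv (n-1) _ _ _ (hfib x) (hfib y) (hfib (t * x + (1-t) * y)) t ht ht1 (by
      intro u hu v hv
      have := hKconv hu hv ht.le (by linarith : 0 ≤ 1 - t) (by ring)
      simpa using this)
    have := ENNReal.toReal_mono (hFT _) this
    rw [ENNReal.toReal_mul, ← ENNReal.toReal_rpow, ← ENNReal.toReal_rpow] at this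
    exact this
  obtain ⟨R, hRpos, hR⟩ := hKcomp.isBounded.exists_pos_norm_lt
  have hsupp : ∀ x, R ≤ |x| → f x = 0 := by
    intro x hx
    have : {y : EuclideanSpace ℝ (Fin (n - 1)) | (x, y) ∈ K} = ∅ := by
      ext y
      simp only [mem_ofPred_eq, mem_empty_iff_false, iff_false]
      intro h
      have h1 := hR _ h
      have h2 : ‖x‖ ≤ ‖(x, y)‖ := norm_fst_le (x, y)
      rw [Real.norm_eq_abs] at h2
      linarith
    simp [hf, hF, this]
  have hint : IntegrableOn (fun p : ℝ × EuclideanSpace ℝ (Fin (n - 1)) => p) K :=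
    continuous_id.continuousOn.integrableOn_compact hKcomp
  have hint1 : Integrable (K.indicator (fun p : ℝ × EuclideanSpace ℝ (Fin (n - 1)) => p.1)) :=
    (integrable_indicator_iff hKm).2 hint.fst
  have inner : ∀ x, ∫ y, K.indicator (fun p : ℝ × EuclideanSpace ℝ (Fin (n - 1)) => p.1) (x, y) = x * f x := by
    intro x
    have : (fun y => K.indicator (fun p : ℝ × EuclideanSpace ℝ (Fin (n - 1)) => p.1) (x, y)) = 
      {y : EuclideanSpace ℝ (Fin (n - 1)) | (x, y) ∈ K}.indicator (fun _ => x) := by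
      ext y; simp [indicator]
    rw [this, integral_indicator (hfib x), setIntegral_const, smul_eq_mul, mul_comm]
    rfl
  have hi : Integrable (fun x => x * f x) := by
    have := Integrable.integral_prod_left (μ := (volume : Measure ℝ)) (ν := (volume : Measure (EuclideanSpace ℝ (Fin (n - 1))))) hint1
    simpa only [inner] using this
  have h0 : ∫ x, x * f x = 0 := by
    have h1 := congrArg Prod.fst hH1
    rw [fst_integral hint, ← integral_indicator hKm] at h1
    have h2 := integral_prod (μ := (volume : Measure ℝ)) (ν := (volume : Measure (EuclideanSpace ℝ (Fin (n - 1))))) _ hint1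
    simp only [inner] at h2
    rw [← h2]; exact h1
  have hne : ¬ f =ᵐ[volume] 0 := by
    intro h
    have h1 : volume K = ∫⁻ x, F x := Measure.prod_apply (μ := (volume : Measure ℝ)) (ν := (volume : Measure (EuclideanSpace ℝ (Fin (n - 1))))) hKm
    have h2 : F =ᵐ[volume] 0 := by
      filter_upwards [h] with x hx
      simpa [hf, hFT x, ENNReal.toReal_eq_zero_iff] using hx
    rw [lintegral_congr_ae h2, hH4] at h1
    simp at h1
  have main : Real.exp (-1) ≤ f 0 := by
    rcases lt_trichotomy m 0 with hm0 | hm0 | hm0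
    · have := oneD (fun x => f (-x)) (by simpa using hi.comp_neg.neg) (fun x => hnn _) R (-m) hRpos (by linarith)
        (fun x hx => hsupp _ (by rw [le_abs]; left; linarith)) (by simpa using hfm)
        (fun x y t ht ht1 => by
          have := hlc (-x) (-y) t ht ht1
          convert this using 2; ring) 
        (fun h => hne (by
          have := (Measure.measurePreserving_neg (volume : Measure ℝ)).quasiMeasurePreserving.ae_eq_comp h
          filter_upwards [this] with x hx
          simpa using hx))
        (by
          have h1 := integral_neg_eq_self (fun x => x * f x) (volume : Measure ℝ)
          rw [h0] at h1
          have h2 : (fun x => x * f (-x)) = fun x => -(-x * f (-x)) := by ext; ring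
          rw [h2, integral_neg, h1, neg_zero])
      simpa using this
    · rw [← hm0, hfm]; simp
    · exact oneD f hi hnn R m hRpos hm0 (fun x hx => hsupp x (by rw [le_abs]; right; linarith)) hfm hlc hne h0
  have e3 : 1 / (3 * (n:ℝ)) ≤ f 0 := by
    refine le_trans ?_ main
    rw [Real.exp_neg, ← one_div]
    have h1 := Real.exp_one_lt_d9
    have h2 : (2:ℝ) ≤ n := by exact_mod_cast hn
    apply one_div_le_one_div_of_le (Real.exp_pos _); linarith
  have e4 : (1 / (3 * (n : ENNReal))) = ENNReal.ofReal (1 / (3 * (n:ℝ))) := by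
    have : (0:ℝ) < n := by exact_mod_cast (by omega : 0 < n)
    rw [ENNReal.ofReal_div_of_pos (by positivity), ENNReal.ofReal_mul (by norm_num)]
    simp
  rw [e4]
  exact ENNReal.ofReal_le_of_le_toReal e3
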